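/- Write G = G_p(A,I). Let D_k(G) denote the derived series (D_0(G) = G, D_{k+1}(G) = [D_k(G), D_k(G)]) and Γ_k(G) the lower central series (Γ_0(G) = G, Γ_{k+1}(G) = [Γ_k(G), G]). Then D_1(G) = Γ_1(G) ≤ G_p^(0.5)(A,I), and for every integer k ≥ 1, D_{k+1}(G) ≤ G_p^(2k)(A,I) and Γ_{k+1}(G) ≤ G_p^(k+0.5)(A,I). -/

import Mathlib

/-- The product of two coefficient sequences, encoding substitution of the power series
`∑_{j≥0} α_j X^(p^j)` into `∑_{i≥0} β_i X^(p^i)`: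
`(α·β)_i = ∑_{j=0}^{i} (α_{i−j})^(p^j) · β_j`. -/
def seqMul {A : Type*} [CommRing A] (p : ℕ) (α β : ℕ → A) : ℕ → A :=
  fun i => ∑ j ∈ Finset.range (i + 1), α (i - j) ^ p ^ j * β j

/-- The identity sequence `δ`, with `δ_0 = 1` and `δ_i = 0` for `i ≥ 1`. -/
def seqOne {A : Type*} [CommRing A] : ℕ → A :=
  fun i => if i = 0 then 1 else 0

/-- `I` is a square-zero ideal: `x·y = 0` for all `x, y ∈ I`. -/
def IsSqZero {A : Type*} [CommRing A] (I : Ideal A) : Prop :=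
  ∀ x ∈ I, ∀ y ∈ I, x * y = 0

/-- The Steenrod group `G_p(A,I)`: sequences `α : ℕ → A` with `α 0 - 1 ∈ I`. -/
def steenrodSet {A : Type*} [CommRing A] (I : Ideal A) : Set (ℕ → A) :=
  {α | α 0 - 1 ∈ I}

/-- The filtration subgroup `G_p^(k)(A,I)`: sequences with `α_0 = 1` and `α_i = 0`
for `1 ≤ i ≤ k`. -/
def steenrodFil {A : Type*} [CommRing A] (k : ℕ) : Set (ℕ → A) :=
  {α | α 0 = 1 ∧ ∀ i : ℕ, 1 ≤ i → i ≤ k → α i = 0}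

/-- The filtration subgroup `G_p^(k+0.5)(A,I)`: elements of `G_p^(k)(A,I)` with
`α_{k+1} ∈ I`. -/
def steenrodFilHalf {A : Type*} [CommRing A] (I : Ideal A) (k : ℕ) : Set (ℕ → A) :=
  {α | α ∈ steenrodFil k ∧ α (k + 1) ∈ I}

/-- `S` is a subgroup for the product `seqMul p`: it contains the identity `δ`, is
closed under the product, and is closed under two-sided inverses. -/
def IsSeqSubgroup {A : Type*} [CommRing A] (p : ℕ) (S : Set (ℕ → A)) : Prop :=
  seqOne ∈ S ∧
  (∀ a ∈ S, ∀ b ∈ S, seqMul p a b ∈ S) ∧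
  (∀ a ∈ S, ∀ a' : ℕ → A, seqMul p a a' = seqOne → seqMul p a' a = seqOne → a' ∈ S)

/-- The set of commutators `(a⁻¹·b⁻¹)·(a·b)` with `a ∈ H` and `b ∈ K` (inverses being
two-sided inverses for the product `seqMul p`). -/
def commSet {A : Type*} [CommRing A] (p : ℕ) (H K : Set (ℕ → A)) : Set (ℕ → A) :=
  {c | ∃ a ∈ H, ∃ b ∈ K, ∃ a' b' : ℕ → A,
    seqMul p a a' = seqOne ∧ seqMul p a' a = seqOne ∧
    seqMul p b b' = seqOne ∧ seqMul p b' b = seqOne ∧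
    c = seqMul p (seqMul p a' b') (seqMul p a b)}

/-- The subgroup (for the product `seqMul p`) generated by a set `S` of sequences:
the smallest set containing `S` and `δ`, closed under the product and under two-sided
inverses. -/
inductive SeqSubgroupClosure {A : Type*} [CommRing A] (p : ℕ) (S : Set (ℕ → A)) :
    (ℕ → A) → Prop
  | of {x : ℕ → A} : x ∈ S → SeqSubgroupClosure p S x
  | one : SeqSubgroupClosure p S seqOne
  | mul {x y : ℕ → A} : SeqSubgroupClosure p S x → SeqSubgroupClosure p S y →
      SeqSubgroupClosure p S (seqMul p x y)
  | inv {x y : ℕ → A} : SeqSubgroupClosure p S x → seqMul p x y = seqOne →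
      seqMul p y x = seqOne → SeqSubgroupClosure p S y

/-- The derived series of `G_p(A,I)`: `D_0 = G_p(A,I)` and
`D_{k+1} = [D_k, D_k]`, the subgroup generated by commutators. -/
def seqDerivedSeries {A : Type*} [CommRing A] (p : ℕ) (I : Ideal A) : ℕ → Set (ℕ → A)
  | 0 => steenrodSet I
  | k + 1 => {x | SeqSubgroupClosure p
      (commSet p (seqDerivedSeries p I k) (seqDerivedSeries p I k)) x}

/-- The lower central series of `G_p(A,I)`: `Γ_0 = G_p(A,I)` and
`Γ_{k+1} = [Γ_k, G_p(A,I)]`, the subgroup generated by commutators. -/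
def lowerCentralSeries' {A : Type*} [CommRing A] (p : ℕ) (I : Ideal A) : ℕ → Set (ℕ → A)
  | 0 => steenrodSet I
  | k + 1 => {x | SeqSubgroupClosure p
      (commSet p (lowerCentralSeries' p I k) (steenrodSet I)) x}

section SeqMul

variable {A B : Type*} [CommRing A] [CommRing B] {p : ℕ}

theorem seqMul_eq_sum_antidiagonal (a b : ℕ → A) (n : ℕ) :
    seqMul p a b n = ∑ x ∈ Finset.HasAntidiagonal.antidiagonal n, a x.2 ^ p ^ x.1 * b x.1 :=
  (Finset.Nat.sum_antidiagonal_eq_sum_range_succ (fun i j => a j ^ p ^ i * b i) n).symm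

theorem seqOne_seqMul (hp : p ≠ 0) (a : ℕ → A) : seqMul p seqOne a = a := by
  funext n
  rw [seqMul, Finset.sum_range_succ, Finset.sum_eq_zero, zero_add]
  · simp [seqOne]
  · intro j hj
    have : n - j ≠ 0 := by have := Finset.mem_range.1 hj; omega
    simp [seqOne, this, hp]

theorem seqMul_seqOne (a : ℕ → A) : seqMul p a seqOne = a := by
  funext n
  rw [seqMul, Finset.sum_range_succ', Finset.sum_eq_zero, zero_add]
  · simp [seqOne]
  · intro j _
    simp [seqOne]

theorem seqMul_assoc [Fact p.Prime] [CharP A p] (a b c : ℕ → A) :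
    seqMul p (seqMul p a b) c = seqMul p a (seqMul p b c) := by
  funext n
  simp only [seqMul_eq_sum_antidiagonal, sum_pow_char_pow, Finset.sum_mul, Finset.mul_sum]
  rw [Finset.sum_sigma', Finset.sum_sigma']
  refine Finset.sum_nbij'
    (fun x : (_ : ℕ × ℕ) × (ℕ × ℕ) => ⟨(x.1.1 + x.2.1, x.2.2), (x.1.1, x.2.1)⟩)
    (fun x : (_ : ℕ × ℕ) × (ℕ × ℕ) => ⟨(x.2.1, x.2.2 + x.1.2), (x.2.2, x.1.2)⟩) ?_ ?_ ?_ ?_ ?_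
  · rintro ⟨⟨i, j⟩, ⟨k, l⟩⟩ h
    simp only [Finset.mem_sigma, Finset.HasAntidiagonal.mem_antidiagonal, and_true] at h ⊢
    omega
  · rintro ⟨⟨i, j⟩, ⟨k, l⟩⟩ h
    simp only [Finset.mem_sigma, Finset.HasAntidiagonal.mem_antidiagonal, and_true] at h ⊢
    omega
  · rintro ⟨⟨i, j⟩, ⟨k, l⟩⟩ h
    simp only [Finset.mem_sigma, Finset.HasAntidiagonal.mem_antidiagonal] at h
    simp [h.2]
  · rintro ⟨⟨i, j⟩, ⟨k, l⟩⟩ h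
    simp only [Finset.mem_sigma, Finset.HasAntidiagonal.mem_antidiagonal] at h
    simp [h.2]
  · rintro ⟨⟨i, j⟩, ⟨k, l⟩⟩ -
    simp only [mul_pow, ← pow_mul, ← pow_add]
    rw [add_comm k i, mul_assoc]

/-- The sequences `u` and `v` have the same image under `f` in all degrees at most `n`. -/
def SeqEqUpTo (f : A →+* B) (n : ℕ) (u v : ℕ → A) : Prop :=
  ∀ i ≤ n, f (u i) = f (v i)

theorem SeqEqUpTo.seqMul {f : A →+* B} {n : ℕ} {u u' v v' : ℕ → A}
    (hu : SeqEqUpTo f n u u') (hv : SeqEqUpTo f n v v') :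
    SeqEqUpTo f n (seqMul p u v) (seqMul p u' v') := by
  intro i hi
  simp only [_root_.seqMul, map_sum, map_mul, map_pow]
  refine Finset.sum_congr rfl fun j hj => ?_
  have := Finset.mem_range.1 hj
  rw [hu (i - j) (by omega), hv j (by omega)]

theorem SeqEqUpTo.succ {f : A →+* B} {n : ℕ} {u v : ℕ → A} (h : SeqEqUpTo f n u v)
    (h' : f (u (n + 1)) = f (v (n + 1))) : SeqEqUpTo f (n + 1) u v := by
  intro i hi
  rcases Nat.le_succ_iff.1 hi with hi | rfl
  exacts [h i hi, h']

theorem SeqEqUpTo.inv (hp : p ≠ 0) {f : A →+* B} {n : ℕ} {x y : ℕ → A}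
    (hx : SeqEqUpTo f n x seqOne) (hxy : _root_.seqMul p x y = seqOne) :
    SeqEqUpTo f n y seqOne := by
  have h := hx.seqMul (p := p) (v := y) (v' := y) fun _ _ => rfl
  rw [hxy, seqOne_seqMul hp] at h
  exact fun i hi => (h i hi).symm

theorem SeqSubgroupClosure.seqEqUpTo (hp : p ≠ 0) {f : A →+* B} {n : ℕ} {S : Set (ℕ → A)}
    (hS : ∀ x ∈ S, SeqEqUpTo f n x seqOne) {x : ℕ → A} (hx : SeqSubgroupClosure p S x) :
    SeqEqUpTo f n x seqOne := by
  induction hx with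
  | of h => exact hS _ h
  | one => exact fun _ _ => rfl
  | mul _ _ hx hy => simpa only [seqOne_seqMul hp] using hx.seqMul (p := p) hy
  | inv _ h _ hx => exact hx.inv hp h

/-- If `a·b` and `b·a` agree in degrees at most `n` for all `a ∈ H`, `b ∈ K`, then the subgroup
generated by the commutators of `H` and `K` is trivial in these degrees. -/
theorem seqEqUpTo_of_commSet [Fact p.Prime] [CharP A p] {f : A →+* B} {n : ℕ}
    {H K : Set (ℕ → A)}
    (hHK : ∀ a ∈ H, ∀ b ∈ K, SeqEqUpTo f n (seqMul p a b) (seqMul p b a)) {x : ℕ → A}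
    (hx : SeqSubgroupClosure p (commSet p H K) x) : SeqEqUpTo f n x seqOne := by
  have hp : p ≠ 0 := (Fact.out : p.Prime).ne_zero
  refine hx.seqEqUpTo hp ?_
  rintro c ⟨a, ha, b, hb, a', b', -, ha', -, hb', rfl⟩
  have h := SeqEqUpTo.seqMul (p := p) (u := seqMul p a' b') (fun _ _ => rfl) (hHK a ha b hb)
  rwa [seqMul_assoc a' b' (seqMul p b a), ← seqMul_assoc b' b a, hb', seqOne_seqMul hp, ha'] at h

theorem map_seqMul_succ (f : A →+* B) {n : ℕ} {a b : ℕ → A}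
    (h : ∀ j < n, f (a (n - j)) ^ p ^ (j + 1) * f (b (j + 1)) = 0) :
    f (seqMul p a b (n + 1)) =
      f (a (n + 1)) * f (b 0) + f (a 0) ^ p ^ (n + 1) * f (b (n + 1)) := by
  rw [seqMul, map_sum, Finset.sum_range_succ, Finset.sum_range_succ', Finset.sum_eq_zero]
  · simp
  · intro j hj
    simpa using h j (Finset.mem_range.1 hj)

theorem SeqEqUpTo.map_zero_eq_one {f : A →+* B} {n : ℕ} {a : ℕ → A}
    (ha : SeqEqUpTo f n a seqOne) : f (a 0) = 1 := by
  simpa [seqOne] using ha 0 (Nat.zero_le n)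

theorem SeqEqUpTo.map_eq_zero {f : A →+* B} {n : ℕ} {a : ℕ → A}
    (ha : SeqEqUpTo f n a seqOne) {i : ℕ} (hi : i ≠ 0) (hin : i ≤ n) : f (a i) = 0 := by
  simpa [seqOne, hi] using ha i hin

/-- A sequence trivial in degrees at most `n` commutes up to degree `n + 1` with any sequence
whose leading coefficient fixes its coefficient in degree `n + 1`. -/
theorem SeqEqUpTo.seqMul_comm (hp : p ≠ 0) {f : A →+* B} {n : ℕ} {a b : ℕ → A}
    (ha : SeqEqUpTo f n a seqOne)
    (hb : f (b 0) ^ p ^ (n + 1) = 1) (hab : f (a (n + 1)) * f (b 0) = f (a (n + 1))) :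
    SeqEqUpTo f (n + 1) (_root_.seqMul p a b) (_root_.seqMul p b a) := by
  have hab_eq := ha.seqMul (p := p) (v := b) (v' := b) fun _ _ => rfl
  have hba_eq := SeqEqUpTo.seqMul (p := p) (u := b) (u' := b) (fun _ _ => rfl) ha
  rw [seqOne_seqMul hp] at hab_eq
  rw [seqMul_seqOne] at hba_eq
  refine SeqEqUpTo.succ (fun i hi => (hab_eq i hi).trans (hba_eq i hi).symm) ?_
  · rw [map_seqMul_succ, map_seqMul_succ, hb, hab, ha.map_zero_eq_one]
    · ring
    · intro j hj
      rw [ha.map_eq_zero (by omega) (by omega), mul_zero]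
    · intro j hj
      rw [ha.map_eq_zero (by omega) (by omega), zero_pow (by simp [hp]), zero_mul]

theorem mem_steenrodFil_iff {k : ℕ} {a : ℕ → A} :
    a ∈ steenrodFil k ↔ SeqEqUpTo (RingHom.id A) k a seqOne := by
  refine ⟨fun h i hi => ?_, fun h => ⟨h.map_zero_eq_one, fun i h1 hi => ?_⟩⟩
  · rcases Nat.eq_zero_or_pos i with rfl | hpos
    · exact h.1
    · simpa [seqOne, hpos.ne'] using h.2 i hpos hi
  · exact h.map_eq_zero (by omega) hi

theorem mem_steenrodFilHalf_iff {I : Ideal A} {k : ℕ} {a : ℕ → A} :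
    a ∈ steenrodFilHalf I k ↔ SeqEqUpTo (RingHom.id A) k a seqOne ∧
      SeqEqUpTo (Ideal.Quotient.mk I) (k + 1) a seqOne := by
  refine and_congr_left' mem_steenrodFil_iff |>.trans (and_congr_right fun h => ?_)
  have h0 : a (k + 1) ∈ I ↔
      Ideal.Quotient.mk I (a (k + 1)) = Ideal.Quotient.mk I (seqOne (k + 1)) := by
    simp [seqOne, Ideal.Quotient.eq_zero_iff_mem]
  rw [h0]
  exact ⟨fun h' => SeqEqUpTo.succ (fun i hi => congrArg _ (h i hi)) h', fun h' => h' _ le_rfl⟩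

theorem IsSqZero.pow_eq_zero {I : Ideal A} (hI : IsSqZero I) {x : A} (hx : x ∈ I) {n : ℕ}
    (hn : 2 ≤ n) : x ^ n = 0 :=
  pow_eq_zero_of_le hn ((sq x).trans (hI x hx x hx))

theorem mk_zero_eq_one_of_mem_steenrodSet {I : Ideal A} {a : ℕ → A} (ha : a ∈ steenrodSet I) :
    Ideal.Quotient.mk I (a 0) = 1 :=
  Ideal.Quotient.eq.2 ha

theorem pow_eq_one_of_mem_steenrodSet [Fact p.Prime] [CharP A p] {I : Ideal A}
    (hI : IsSqZero I) {a : ℕ → A} (ha : a ∈ steenrodSet I) (n : ℕ) :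
    a 0 ^ p ^ (n + 1) = 1 := by
  have hp : p.Prime := Fact.out
  have h := hI.pow_eq_zero ha (hp.two_le.trans (Nat.le_self_pow n.succ_ne_zero p))
  rwa [sub_pow_char_pow, one_pow, sub_eq_zero] at h

theorem seqMul_comm_of_steenrodFilHalf [Fact p.Prime] [CharP A p] {I : Ideal A}
    (hI : IsSqZero I) {k : ℕ} {a b : ℕ → A} (ha : a ∈ steenrodFilHalf I k)
    (hb : b ∈ steenrodSet I) :
    SeqEqUpTo (RingHom.id A) (k + 1) (seqMul p a b) (seqMul p b a) ∧
      SeqEqUpTo (Ideal.Quotient.mk I) (k + 2) (seqMul p a b) (seqMul p b a) := by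
  have hp : p ≠ 0 := (Fact.out : p.Prime).ne_zero
  have hb' := mk_zero_eq_one_of_mem_steenrodSet hb
  obtain ⟨h, h'⟩ := mem_steenrodFilHalf_iff.1 ha
  refine ⟨h.seqMul_comm hp (pow_eq_one_of_mem_steenrodSet hI hb k) ?_,
    h'.seqMul_comm hp (by simp [hb']) (by simp [hb'])⟩
  have := hI _ ha.2 _ hb
  rwa [mul_sub, mul_one, sub_eq_zero] at this

theorem lowerCentralSeries'_succ_subset [Fact p.Prime] [CharP A p] {I : Ideal A}
    (hI : IsSqZero I) (k : ℕ) : lowerCentralSeries' p I (k + 1) ⊆ steenrodFilHalf I k := by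
  have hp : p ≠ 0 := (Fact.out : p.Prime).ne_zero
  induction k with
  | zero =>
    refine fun x hx => mem_steenrodFilHalf_iff.2
      ⟨seqEqUpTo_of_commSet (fun a _ b _ => ?_) hx, seqEqUpTo_of_commSet (fun a ha b hb => ?_) hx⟩
    · intro i hi
      obtain rfl : i = 0 := by omega
      simp [seqMul, mul_comm]
    · have hb' := mk_zero_eq_one_of_mem_steenrodSet hb
      refine SeqEqUpTo.seqMul_comm hp (fun i hi => ?_) (by simp [hb']) (by simp [hb'])
      obtain rfl : i = 0 := by omega
      simpa [seqOne] using mk_zero_eq_one_of_mem_steenrodSet ha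
  | succ k ih =>
    exact fun x hx => mem_steenrodFilHalf_iff.2
      ⟨seqEqUpTo_of_commSet
        (fun a ha b hb => (seqMul_comm_of_steenrodFilHalf hI (ih ha) hb).1) hx,
      seqEqUpTo_of_commSet
        (fun a ha b hb => (seqMul_comm_of_steenrodFilHalf hI (ih ha) hb).2) hx⟩

theorem seqMul_comm_two_of_steenrodFilHalf (hp : p.Prime) {I : Ideal A} (hI : IsSqZero I)
    {a b : ℕ → A} (ha : a ∈ steenrodFilHalf I 0) (hb : b ∈ steenrodFilHalf I 0) :
    SeqEqUpTo (RingHom.id A) 2 (seqMul p a b) (seqMul p b a) := by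
  have h1 := (mem_steenrodFilHalf_iff.1 ha).1.seqMul_comm (b := b) hp.ne_zero
    (by simp [hb.1.1]) (by simp [hb.1.1])
  have h2 {c d : ℕ → A} (hc : c ∈ steenrodFilHalf I 0) (j : ℕ) (hj : j < 1) :
      RingHom.id A (c (1 - j)) ^ p ^ (j + 1) * RingHom.id A (d (j + 1)) = 0 := by
    obtain rfl : j = 0 := by omega
    simp [hI.pow_eq_zero hc.2 hp.two_le]
  refine h1.succ ?_
  rw [map_seqMul_succ _ (h2 ha), map_seqMul_succ _ (h2 hb)]
  simp [ha.1.1, hb.1.1, add_comm]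

theorem seqMul_comm_of_steenrodFil (hp : p ≠ 0) {k : ℕ} (hk : 1 ≤ k) {a b : ℕ → A}
    (ha : a ∈ steenrodFil k) (hb : b ∈ steenrodFil k) :
    SeqEqUpTo (RingHom.id A) (k + 2) (seqMul p a b) (seqMul p b a) := by
  have h1 := (mem_steenrodFil_iff.1 ha).seqMul_comm (b := b) hp
    (by simp [hb.1]) (by simp [hb.1])
  have h2 {c d : ℕ → A} (hc : c ∈ steenrodFil k) (hd : d ∈ steenrodFil k) (j : ℕ)
      (hj : j < k + 1) :
      RingHom.id A (c (k + 1 - j)) ^ p ^ (j + 1) * RingHom.id A (d (j + 1)) = 0 := by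
    rcases Nat.lt_or_ge j k with hjk | hjk
    · simp [hd.2 (j + 1) (by omega) (by omega)]
    · simp [hc.2 (k + 1 - j) (by omega) (by omega), hp]
  refine h1.succ ?_
  rw [map_seqMul_succ _ (h2 ha hb), map_seqMul_succ _ (h2 hb ha)]
  simp [ha.1, hb.1, add_comm]

theorem seqDerivedSeries_add_two_subset [Fact p.Prime] [CharP A p] {I : Ideal A}
    (hI : IsSqZero I) (k : ℕ) : seqDerivedSeries p I (k + 2) ⊆ steenrodFil (2 * (k + 1)) := by
  have hp : p.Prime := Fact.out
  induction k with
  | zero =>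
    have h : seqDerivedSeries p I 1 ⊆ steenrodFilHalf I 0 := lowerCentralSeries'_succ_subset hI 0
    exact fun x hx => mem_steenrodFil_iff.2 <| seqEqUpTo_of_commSet
      (fun a ha b hb => seqMul_comm_two_of_steenrodFilHalf hp hI (h ha) (h hb)) hx
  | succ k ih =>
    exact fun x hx => mem_steenrodFil_iff.2 <| seqEqUpTo_of_commSet
      (fun a ha b hb => seqMul_comm_of_steenrodFil hp.ne_zero (by omega) (ih ha) (ih hb)) hx

end SeqMul

/-- Let `p` be a prime, `A` a commutative ring of characteristic `p`,
`I` a square-zero ideal of `A` and `G = G_p(A,I)`.  Then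
`D_1(G) = Γ_1(G) ≤ G_p^(0.5)(A,I)` and, for every `k ≥ 1`,
`D_{k+1}(G) ≤ G_p^(2k)(A,I)` and `Γ_{k+1}(G) ≤ G_p^(k+0.5)(A,I)`. -/
theorem steenrod_derived_lowerCentral {A : Type*} [CommRing A] (p : ℕ) (hp : p.Prime)
    [CharP A p] (I : Ideal A) (hI : IsSqZero I) :
    seqDerivedSeries p I 1 = lowerCentralSeries' p I 1 ∧
    seqDerivedSeries p I 1 ⊆ steenrodFilHalf I 0 ∧
    (∀ k : ℕ, 1 ≤ k →
      seqDerivedSeries p I (k + 1) ⊆ steenrodFil (2 * k) ∧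
      lowerCentralSeries' p I (k + 1) ⊆ steenrodFilHalf I k) := by
  have : Fact p.Prime := ⟨hp⟩
  refine ⟨rfl, lowerCentralSeries'_succ_subset hI 0, fun k hk => ⟨?_, ?_⟩⟩
  · obtain ⟨k, rfl⟩ := Nat.exists_eq_add_of_le' hk
    exact seqDerivedSeries_add_two_subset hI k
  · exact lowerCentralSeries'_succ_subset hI k
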